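/- arXiv:1005.5194 — 4 statements merged into one kernel-verified Lean document; each statement's English description precedes it below -/
import Mathlib

section
/- Let $v$ be a vertex in a 2-connected finite simple graph $G$ with at least 4 vertices. Then there exists an edge $vw$ incident to $v$ such that the graph $G / vw$ obtained by contracting the edge $vw$ is 2-connected. -/
/-- A graph is 2-connected if it is connected, has at least 3 vertices, and
remains connected after deleting any single vertex. -/
def TwoConnected {V : Type} (G : SimpleGraph V) : Prop :=
  G.Connected ∧ 3 ≤ Nat.card V ∧ ∀ v : V, (G.induce {u | u ≠ v}).Connected

/-- `G / vw`: the simple graph obtained from `G` by contracting the edge `vw`,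
identifying `v` and `w` (the merged vertex is `v`; `w` is deleted) and deleting
any resulting parallel edges and loops. -/
def contractEdge {V : Type} (G : SimpleGraph V) (v w : V) :
    SimpleGraph {u : V // u ≠ w} :=
  SimpleGraph.fromRel (fun a b =>
    G.Adj a b ∨ ((a : V) = v ∧ G.Adj w b) ∨ ((b : V) = v ∧ G.Adj (a : V) w))

/-- A surjective map sending every edge to an edge or to a single vertex preserves
connectedness. -/
theorem connected_of_surjective_of_adj {V W : Type*} {G : SimpleGraph V} {H : SimpleGraph W}
    (f : V → W) (hf : Function.Surjective f)
    (hadj : ∀ a b, G.Adj a b → f a = f b ∨ H.Adj (f a) (f b)) (hG : G.Connected) :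
    H.Connected := by
  have hreach : ∀ a b, G.Reachable a b → H.Reachable (f a) (f b) := by
    rintro a b ⟨p⟩
    induction p with
    | nil => exact .refl _
    | cons h _ ih =>
      rcases hadj _ _ h with h | h
      · rwa [h]
      · exact h.reachable.trans ih
  have := hG.nonempty
  refine (SimpleGraph.connected_iff _).2 ⟨fun x y => ?_, this.map f⟩
  obtain ⟨a, rfl⟩ := hf x
  obtain ⟨b, rfl⟩ := hf y
  exact hreach a b (hG.preconnected a b)

theorem contractEdge_adj {V : Type} {G : SimpleGraph V} {v w : V} {a b : {u : V // u ≠ w}} :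
    (contractEdge G v w).Adj a b ↔
      a ≠ b ∧ (G.Adj a b ∨ ((a : V) = v ∧ G.Adj w b) ∨ ((b : V) = v ∧ G.Adj a w)) := by
  simp only [contractEdge, SimpleGraph.fromRel_adj, G.adj_comm b a, G.adj_comm w a,
    G.adj_comm b w]
  tauto

/-- Contracting `vw` preserves 2-connectedness when deleting both `v` and `w` leaves a connected
graph. -/
theorem twoConnected_contractEdge {V : Type} [Finite V] {G : SimpleGraph V} (hG : TwoConnected G)
    (hcard : 4 ≤ Nat.card V) {v w : V} (hvw : v ≠ w)
    (hK : (G.induce {u | u ≠ v ∧ u ≠ w}).Connected) : TwoConnected (contractEdge G v w) := by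
  classical
  let f : V → {u : V // u ≠ w} := fun a => if h : a = w then ⟨v, hvw⟩ else ⟨a, h⟩
  have hfw : f w = ⟨v, hvw⟩ := by simp [f]
  have hf : ∀ a (h : a ≠ w), f a = ⟨a, h⟩ := fun a h => by simp [f, h]
  have hadj : ∀ a b, G.Adj a b → f a = f b ∨ (contractEdge G v w).Adj (f a) (f b) := by
    intro a b hab
    rw [or_iff_not_imp_left, contractEdge_adj]
    refine fun hne => ⟨hne, ?_⟩
    by_cases ha : a = w
    · subst ha
      have hb : b ≠ a := hab.ne'
      simp [hfw, hf b hb, hab]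
    · by_cases hb : b = w
      · subst hb
        simp [hfw, hf a ha, hab]
      · simp [hf a ha, hf b hb, hab]
  refine ⟨connected_of_surjective_of_adj f (fun x => ⟨x, hf x x.2⟩) hadj hG.1, ?_, ?_⟩
  · have := Fintype.ofFinite V
    rw [Nat.card_eq_fintype_card] at hcard ⊢
    rw [Fintype.card_subtype_compl, Fintype.card_subtype_eq]
    omega
  · rintro ⟨x, hxw⟩
    by_cases hxv : x = v
    · subst hxv
      refine connected_of_surjective_of_adj
        (fun a : {u | u ≠ x ∧ u ≠ w} => ⟨f a, by simp [hf a a.2.2, a.2.1]⟩) ?_ ?_ hK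
      · rintro ⟨⟨y, hyw⟩, hy⟩
        refine ⟨⟨y, fun h => hy (Subtype.ext h), hyw⟩, Subtype.ext (hf y hyw)⟩
      · intro a b hab
        exact (hadj a b hab).imp Subtype.ext id
    · refine connected_of_surjective_of_adj (fun a : {u | u ≠ x} => ⟨f a, ?_⟩) ?_ ?_ (hG.2.2 x)
      · have hax : (a : V) ≠ x := a.2
        by_cases ha : (a : V) = w
        · simpa [ha, hfw] using Ne.symm hxv
        · simpa [hf a ha] using hax
      · rintro ⟨⟨y, hyw⟩, hy⟩
        refine ⟨⟨y, fun h => hy (Subtype.ext h)⟩, Subtype.ext (hf y hyw)⟩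
      · intro a b hab
        exact (hadj a b hab).imp Subtype.ext id

/-- If `G - w` is connected, every vertex of `G - {v, w}` is joined in `G - {v, w}` to a
neighbour of `v`. -/
theorem exists_adj_reachable_induce {V : Type*} {G : SimpleGraph V} {v w : V} (hvw : v ≠ w)
    (hw : (G.induce {u | u ≠ w}).Connected) (x : {u | u ≠ v ∧ u ≠ w}) :
    ∃ u : {u | u ≠ v ∧ u ≠ w}, G.Adj v u ∧ (G.induce {u | u ≠ v ∧ u ≠ w}).Reachable x u := by
  have key : ∀ a b, (G.induce {u | u ≠ w}).Walk a b → b = ⟨v, hvw⟩ → ∀ ha : (a : V) ≠ v,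
      ∃ u : {u | u ≠ v ∧ u ≠ w}, G.Adj v u ∧
        (G.induce {u | u ≠ v ∧ u ≠ w}).Reachable ⟨a, ha, a.2⟩ u := by
    intro a b p hb
    induction p with
    | nil => exact fun ha => (ha (congrArg Subtype.val hb)).elim
    | @cons a c _ h _ ih =>
      intro ha
      have hac : G.Adj a c := h
      by_cases hc : (c : V) = v
      · exact ⟨⟨a, ha, a.2⟩, hc ▸ hac.symm, .refl _⟩
      · obtain ⟨u, hu, hr⟩ := ih hb hc
        have hac' : (G.induce {u | u ≠ v ∧ u ≠ w}).Adj ⟨a, ha, a.2⟩ ⟨c, hc, c.2⟩ := hac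
        exact ⟨u, hu, hac'.reachable.trans hr⟩
  obtain ⟨p⟩ := hw.preconnected ⟨x, x.2.2⟩ ⟨v, hvw⟩
  exact key _ _ p rfl x.2.1

/-- Every vertex `v` of a 2-connected graph has a neighbour `w` such that
deleting both `v` and `w` leaves a connected graph. -/
theorem TwoConnected.exists_adj_induce_connected {V : Type} [Finite V] {G : SimpleGraph V}
    (hG : TwoConnected G) (v : V) :
    ∃ w, G.Adj v w ∧ (G.induce {u | u ≠ v ∧ u ≠ w}).Connected := by
  classical
  have := Fintype.ofFinite V
  have hcard := hG.2.1
  rw [Nat.card_eq_fintype_card] at hcard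
  have : Nontrivial V := Fintype.one_lt_card_iff_nontrivial.1 (by omega)
  obtain ⟨r, hr⟩ := hG.1.preconnected.exists_adj_of_nontrivial v
  have hH := hG.2.2 v
  set H := G.induce {u | u ≠ v}
  let N : Set {u | u ≠ v} := {u | G.Adj v u}
  -- Take a neighbour of `v` at maximal distance from `r` in `G - v`.
  obtain ⟨w, hw, hmax⟩ := N.toFinite.exists_maximalFor (fun u => H.dist ⟨r, hr.ne'⟩ u) N
    ⟨⟨r, hr.ne'⟩, hr⟩
  have hvw : v ≠ w := w.2.symm
  have hne : ∃ x : V, x ≠ v ∧ x ≠ w := by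
    by_contra! h
    have : (Finset.univ : Finset V) ⊆ {v, (w : V)} := fun x _ => by
      by_cases hx : x = v
      · simp [hx]
      · simp [h x hx]
    have := (Finset.card_le_card this).trans Finset.card_le_two
    rw [Finset.card_univ] at this
    omega
  have avoid : ∀ u : {u | u ≠ v ∧ u ≠ w}, G.Adj v u →
      ∃ hrw : r ≠ w, (G.induce {u | u ≠ v ∧ u ≠ w}).Reachable ⟨r, hr.ne', hrw⟩ u := by
    intro u hu
    obtain ⟨p, hp⟩ := hH.exists_walk_length_eq_dist ⟨r, hr.ne'⟩ ⟨u, u.2.1⟩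
    have hwp : w ∉ p.support := by
      intro hmem
      have hle : H.dist ⟨r, hr.ne'⟩ ⟨u, u.2.1⟩ ≤ H.dist ⟨r, hr.ne'⟩ w := by
        by_contra! hlt
        exact absurd (hmax hu hlt.le) (not_le.2 hlt)
      have hlen := congrArg SimpleGraph.Walk.length (p.take_spec hmem)
      rw [SimpleGraph.Walk.length_append] at hlen
      have h1 := SimpleGraph.dist_le (p.takeUntil w hmem)
      have h2 : (p.dropUntil w hmem).length = 0 := by omega
      exact u.2.2 (congrArg Subtype.val (SimpleGraph.Walk.eq_of_length_eq_zero h2)).symm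
    have hsupp : ∀ x ∈ (p.map (SimpleGraph.Embedding.induce {u | u ≠ v}).toHom).support,
        x ∈ {u | u ≠ v ∧ u ≠ (w : V)} := by
      intro x hx
      rw [SimpleGraph.Walk.support_map, List.mem_map] at hx
      obtain ⟨y, hy, rfl⟩ := hx
      exact ⟨y.2, fun h => hwp (Subtype.ext h ▸ hy)⟩
    exact ⟨(hsupp _ (SimpleGraph.Walk.start_mem_support _)).2,
      ⟨SimpleGraph.Walk.induce _ _ hsupp⟩⟩
  have reach : ∀ x : {u | u ≠ v ∧ u ≠ w}, ∃ hrw : r ≠ w,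
      (G.induce {u | u ≠ v ∧ u ≠ w}).Reachable ⟨r, hr.ne', hrw⟩ x := by
    intro x
    obtain ⟨u, hu, hxu⟩ := exists_adj_reachable_induce hvw (hG.2.2 w) x
    obtain ⟨hrw, hru⟩ := avoid u hu
    exact ⟨hrw, hru.trans hxu.symm⟩
  obtain ⟨x, hx⟩ := hne
  refine ⟨w, hw, (SimpleGraph.connected_iff _).2 ⟨fun a b => ?_, ⟨⟨x, hx⟩⟩⟩⟩
  obtain ⟨_, ha⟩ := reach a
  obtain ⟨_, hb⟩ := reach b
  exact ha.symm.trans hb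

/-- In a 2-connected graph with at least 4 vertices, every vertex `v` has an
incident edge `vw` whose contraction yields a 2-connected graph. -/
theorem exists_contractible_edge {V : Type} [Fintype V] (G : SimpleGraph V)
    (hG : TwoConnected G) (hcard : 4 ≤ Fintype.card V) (v : V) :
    ∃ w : V, G.Adj v w ∧ TwoConnected (contractEdge G v w) := by
  obtain ⟨w, hw, hK⟩ := hG.exists_adj_induce_connected v
  exact ⟨w, hw, twoConnected_contractEdge hG (by rwa [Nat.card_eq_fintype_card]) hw.ne hK⟩
end

section
/- Let $x, y, z$ be distinct vertices in a finite simple graph $G$. Then $G$ has a $K_3$-minor rooted at $x, y, z$ if and only if every vertex of $G$ is good with respect to $x, y, z$. -/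
/-- A `K₃`-minor of `G` rooted at `x, y, z`: three pairwise disjoint, pairwise
adjacent connected subgraphs (branch sets) `X, Y, Z` with `x ∈ X`, `y ∈ Y`, `z ∈ Z`. -/
def RootedK3Minor {V : Type} (G : SimpleGraph V) (x y z : V) : Prop :=
  ∃ X Y Z : Set V,
    (G.induce X).Connected ∧ (G.induce Y).Connected ∧ (G.induce Z).Connected ∧
    Disjoint X Y ∧ Disjoint X Z ∧ Disjoint Y Z ∧
    (∃ a ∈ X, ∃ b ∈ Y, G.Adj a b) ∧
    (∃ a ∈ X, ∃ b ∈ Z, G.Adj a b) ∧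
    (∃ a ∈ Y, ∃ b ∈ Z, G.Adj a b) ∧
    x ∈ X ∧ y ∈ Y ∧ z ∈ Z

/-- A vertex `v` is good with respect to `x, y, z` if at least two of `x, y, z`
lie in the same connected component of `G - v`. -/
def Good {V : Type} (G : SimpleGraph V) (x y z v : V) : Prop :=
  ∃ a b : ↥({u : V | u ≠ v} : Set V), a ≠ b ∧
    (a : V) ∈ ({x, y, z} : Set V) ∧ (b : V) ∈ ({x, y, z} : Set V) ∧
    (G.induce {u : V | u ≠ v}).Reachable a b

namespace SimpleGraph

variable {V : Type*} {G : SimpleGraph V}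

/-- Adding to a connected set a vertex adjacent to it keeps it connected. -/
lemma Connected.induce_insert {s : Set V} (hs : (G.induce s).Connected) {a b : V}
    (ha : a ∈ s) (hab : G.Adj a b) : (G.induce (insert b s)).Connected := by
  rw [Set.insert_eq, Set.union_comm]
  refine connected_induce_union hs.preconnected ?_ ha rfl hab
  exact Preconnected.of_subsingleton

/-- Reachability in `G - v` yields a walk in `G` avoiding `v`. -/
lemma Reachable.exists_walk_notMem_support {v : V} {a b : ↥({u : V | u ≠ v} : Set V)}
    (h : (G.induce {u : V | u ≠ v}).Reachable a b) :
    ∃ p : G.Walk a b, v ∉ p.support := by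
  obtain ⟨p⟩ := h
  refine ⟨p.map (Embedding.induce _).toHom, fun hv => ?_⟩
  obtain ⟨u, -, hu⟩ := List.mem_map.1 ((Walk.support_map _ p) ▸ hv)
  exact u.2 hu

/-- A path meeting `A` in two vertices splits into two adjacent connected pieces,
each of which meets `A`. -/
lemma Walk.IsPath.exists_split {A : Set V} {x y : V} {p : G.Walk x y} (hp : p.IsPath)
    {a b : V} (ha : a ∈ p.support) (hb : b ∈ p.support) (hab : a ≠ b)
    (haA : a ∈ A) (hbA : b ∈ A) :
    ∃ X Y : Set V, (G.induce X).Connected ∧ (G.induce Y).Connected ∧ Disjoint X Y ∧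
      (∃ a ∈ X, ∃ b ∈ Y, G.Adj a b) ∧ (∃ a ∈ X, a ∈ A) ∧ (∃ b ∈ Y, b ∈ A) ∧
      x ∈ X ∧ y ∈ Y ∧ (∀ u ∈ X, u ∈ p.support) ∧ (∀ u ∈ Y, u ∈ p.support) := by
  induction p with
  | nil => simp_all
  | @cons x x' y h q ih =>
    obtain ⟨hq, hx⟩ := (Walk.cons_isPath_iff h q).1 hp
    by_cases hxA : x ∈ A
    · obtain ⟨c, hc, hcA⟩ : ∃ c ∈ q.support, c ∈ A := by
        simp only [Walk.support_cons, List.mem_cons] at ha hb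
        grind
      refine ⟨{x}, {u | u ∈ q.support}, by simp, q.connected_induce_support,
        Set.disjoint_singleton_left.2 hx, ⟨x, rfl, x', q.start_mem_support, h⟩,
        ⟨x, rfl, hxA⟩, ⟨c, hc, hcA⟩, rfl, q.end_mem_support, ?_, ?_⟩
      · rintro u rfl
        simp
      · intro u hu
        exact List.mem_cons_of_mem _ hu
    · have haq : a ∈ q.support := by
        simp only [Walk.support_cons, List.mem_cons] at ha
        grind
      have hbq : b ∈ q.support := by
        simp only [Walk.support_cons, List.mem_cons] at hb
        grind
      obtain ⟨X, Y, hX, hY, hXY, ⟨c, hc, d, hd, hcd⟩, ⟨e, he, heA⟩, hYA, hxX, hyY, hXq, hYq⟩ :=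
        ih hq haq hbq
      refine ⟨insert x X, Y, hX.induce_insert hxX h.symm, hY, ?_,
        ⟨c, Or.inr hc, d, hd, hcd⟩, ⟨e, Or.inr he, heA⟩, hYA, Or.inl rfl, hyY, ?_, ?_⟩
      · exact Set.disjoint_insert_left.2 ⟨fun h => hx (hYq x h), hXY⟩
      · rintro u (rfl | hu)
        · simp
        · exact List.mem_cons_of_mem _ (hXq u hu)
      · intro u hu
        exact List.mem_cons_of_mem _ (hYq u hu)

/-- A walk that leaves a set uses an edge leaving that set. -/
lemma Walk.exists_adj_leaving {s : Set V} {a b : V} (p : G.Walk a b) (ha : a ∈ s) (hb : b ∉ s) :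
    ∃ c ∈ s, ∃ d ∉ s, G.Adj c d ∧ d ∈ p.support := by
  obtain ⟨d, hd, hds, hdt⟩ := p.exists_boundary_dart s ha hb
  exact ⟨d.fst, hds, d.snd, hdt, d.adj, p.dart_snd_mem_support_of_mem_darts hd⟩

end SimpleGraph

lemma good_of_adjacent_connected {V : Type} {G : SimpleGraph V} {x y z v a b : V} {A B : Set V}
    (hA : (G.induce A).Connected) (hB : (G.induce B).Connected)
    (hAB : ∃ c ∈ A, ∃ d ∈ B, G.Adj c d) (hab : a ≠ b) (ha : a ∈ A) (hb : b ∈ B)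
    (haS : a ∈ ({x, y, z} : Set V)) (hbS : b ∈ ({x, y, z} : Set V))
    (hvA : v ∉ A) (hvB : v ∉ B) : Good G x y z v := by
  obtain ⟨c, hc, d, hd, hcd⟩ := hAB
  have hsub : A ∪ B ⊆ {u : V | u ≠ v} := by
    rintro u (hu | hu) rfl
    exacts [hvA hu, hvB hu]
  have hconn := SimpleGraph.connected_induce_union hA.preconnected hB.preconnected hc hd hcd
  refine ⟨⟨a, hsub (Or.inl ha)⟩, ⟨b, hsub (Or.inr hb)⟩, fun h => hab (congrArg Subtype.val h),
    haS, hbS, ?_⟩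
  exact (hconn.preconnected ⟨a, Or.inl ha⟩ ⟨b, Or.inr hb⟩).map
    (SimpleGraph.induceHomOfLE G hsub).toHom

lemma RootedK3Minor.good {V : Type} {G : SimpleGraph V} {x y z : V}
    (hxy : x ≠ y) (hxz : x ≠ z) (hyz : y ≠ z) (h : RootedK3Minor G x y z) (v : V) :
    Good G x y z v := by
  obtain ⟨X, Y, Z, hX, hY, hZ, dXY, dXZ, dYZ, aXY, aXZ, aYZ, hx, hy, hz⟩ := h
  by_cases hvX : v ∈ X
  · exact good_of_adjacent_connected hY hZ aYZ hyz hy hz (by simp) (by simp)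
      (Set.disjoint_left.1 dXY hvX) (Set.disjoint_left.1 dXZ hvX)
  by_cases hvY : v ∈ Y
  · exact good_of_adjacent_connected hX hZ aXZ hxz hx hz (by simp) (by simp)
      hvX (Set.disjoint_left.1 dYZ hvY)
  · exact good_of_adjacent_connected hX hY aXY hxy hx hy (by simp) (by simp) hvX hvY

/-- A good vertex is avoided by a walk joining two of the three roots. -/
lemma Good.exists_walk {V : Type} {G : SimpleGraph V} {x y z v : V} (h : Good G x y z v) :
    (x ≠ v ∧ y ≠ v ∧ ∃ p : G.Walk x y, v ∉ p.support) ∨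
    (z ≠ v ∧ x ≠ v ∧ ∃ p : G.Walk z x, v ∉ p.support) ∨
    (z ≠ v ∧ y ≠ v ∧ ∃ p : G.Walk z y, v ∉ p.support) := by
  obtain ⟨⟨a, hav⟩, ⟨b, hbv⟩, hab, ha, hb, hr⟩ := h
  obtain ⟨p, hp⟩ := hr.exists_walk_notMem_support
  obtain ⟨q, hq⟩ := hr.symm.exists_walk_notMem_support
  simp only [Set.mem_insert_iff, Set.mem_singleton_iff, Set.mem_ofPred_eq] at ha hb hav hbv
  rcases ha with rfl | rfl | rfl <;> rcases hb with rfl | rfl | rfl <;>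
    first
    | exact absurd rfl hab
    | exact Or.inl ⟨hav, hbv, p, hp⟩
    | exact Or.inl ⟨hbv, hav, q, hq⟩
    | exact Or.inr (Or.inl ⟨hav, hbv, p, hp⟩)
    | exact Or.inr (Or.inl ⟨hbv, hav, q, hq⟩)
    | exact Or.inr (Or.inr ⟨hav, hbv, p, hp⟩)
    | exact Or.inr (Or.inr ⟨hbv, hav, q, hq⟩)

lemma rootedK3Minor_of_forall_good {V : Type} [Finite V] {G : SimpleGraph V} {x y z : V}
    (h : ∀ v, Good G x y z v) : RootedK3Minor G x y z := by
  classical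
  obtain ⟨p₀, hp₀⟩ : ∃ p : G.Walk x y, z ∉ p.support := by
    rcases (h z).exists_walk with h | h | h
    exacts [h.2.2, absurd rfl h.1, absurd rfl h.1]
  obtain ⟨p₁⟩ : G.Reachable z y := by
    rcases (h x).exists_walk with h | h | h
    exacts [absurd rfl h.1, absurd rfl h.2.1, h.2.2.nonempty]
  let S : Set (Set V) := {C | z ∈ C ∧ (G.induce C).Connected ∧
    ∃ p : G.Walk x y, p.IsPath ∧ ∀ u ∈ p.support, u ∉ C}
  have hS : S.Nonempty := by
    refine ⟨{z}, rfl, by simp, p₀.bypass, p₀.bypass_isPath, ?_⟩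
    rintro u hu rfl
    exact hp₀ (p₀.support_bypass_subset_support hu)
  obtain ⟨C, ⟨hzC, hC, p, hp, hpC⟩, hmax⟩ := (Set.toFinite S).exists_maximal hS
  have hxC := hpC x p.start_mem_support
  have hyC := hpC y p.end_mem_support
  have hmem : ∀ c ∈ C, ∀ d ∉ C, G.Adj c d → ∀ q : G.Walk x y, q.IsPath →
      (∀ u ∈ q.support, u ∉ C) → d ∈ q.support := by
    intro c hc d hd hcd q hq hqC
    by_contra hdq
    refine hd (hmax (y := insert d C) ⟨Or.inr hzC, hC.induce_insert hc hcd, q, hq, ?_⟩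
      (Set.subset_insert d C) (Set.mem_insert d C))
    rintro u hu (rfl | huC)
    exacts [hdq hu, hqC u hu huC]
  obtain ⟨c, hc, w, hw, hcw, -⟩ := p₁.exists_adj_leaving hzC hyC
  by_cases huniq : ∀ c ∈ C, ∀ d ∉ C, G.Adj c d → d = w
  · exfalso
    have avoid : ∀ {a b : V} (q : G.Walk a b), a ∈ C → b ∉ C → w ∈ q.support := by
      intro a b q ha hb
      obtain ⟨c, hc, d, hd, hcd, hdq⟩ := q.exists_adj_leaving ha hb
      exact huniq c hc d hd hcd ▸ hdq
    rcases (h w).exists_walk with ⟨-, -, q, hq⟩ | ⟨-, -, q, hq⟩ | ⟨-, -, q, hq⟩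
    · refine hq (q.support_bypass_subset_support
        (hmem c hc w hw hcw q.bypass q.bypass_isPath fun u hu huC => ?_))
      have hu' := q.support_bypass_subset_support hu
      exact hq (q.support_dropUntil_subset_support hu' (avoid (q.dropUntil u hu') huC hyC))
    · exact hq (avoid q hzC hxC)
    · exact hq (avoid q hzC hyC)
  · push Not at huniq
    obtain ⟨c', hc', w', hw', hcw', hne⟩ := huniq
    obtain ⟨X, Y, hX, hY, dXY, aXY, ⟨e, heX, f, hf, hfe⟩, ⟨e', heY, f', hf', hfe'⟩, hx, hy,
        hXp, hYp⟩ :=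
      hp.exists_split (A := {d | ∃ c ∈ C, G.Adj c d}) (hmem c' hc' w' hw' hcw' p hp hpC)
        (hmem c hc w hw hcw p hp hpC) hne ⟨c', hc', hcw'⟩ ⟨c, hc, hcw⟩
    exact ⟨X, Y, C, hX, hY, hC, dXY, Set.disjoint_left.2 fun u hu => hpC u (hXp u hu),
      Set.disjoint_left.2 fun u hu => hpC u (hYp u hu), aXY, ⟨e, heX, f, hf, hfe.symm⟩,
      ⟨e', heY, f', hf', hfe'.symm⟩, hx, hy, hzC⟩

/-- For distinct vertices `x, y, z` of a finite graph `G`, `G` has a `K₃`-minor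
rooted at `x, y, z` if and only if every vertex of `G` is good w.r.t. `x, y, z`. -/
theorem rootedK3Minor_iff_forall_good {V : Type} [Fintype V] (G : SimpleGraph V)
    (x y z : V) (hxy : x ≠ y) (hxz : x ≠ z) (hyz : y ≠ z) :
    RootedK3Minor G x y z ↔ ∀ v : V, Good G x y z v :=
  ⟨RootedK3Minor.good hxy hxz hyz, rootedK3Minor_of_forall_good⟩
end

section
/- A finite simple graph $G$ with at least 3 vertices contains a $K_3$-minor rooted at $x, y, z$ for all triples of distinct vertices $x, y, z \in V(G)$ if and only if $G$ is 2-connected. -/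
namespace SimpleGraph

variable {V : Type*} {G : SimpleGraph V}

/-- A connected induced subgraph on `S` has an edge leaving any set that meets `S` but does not
contain it. -/
lemma exists_adj_boundary_of_preconnected_induce {S Z : Set V} {a b : V}
    (hS : (G.induce S).Preconnected) (haS : a ∈ S) (haZ : a ∈ Z) (hbS : b ∈ S) (hbZ : b ∉ Z) :
    ∃ c ∈ Z, ∃ d ∈ S, d ∉ Z ∧ G.Adj c d := by
  obtain ⟨p⟩ := hS ⟨a, haS⟩ ⟨b, hbS⟩
  obtain ⟨d, -, h₁, h₂⟩ := p.exists_boundary_dart (Subtype.val ⁻¹' Z) haZ hbZ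
  exact ⟨d.fst, h₁, d.snd, d.snd.2, h₂, d.adj⟩

lemma exists_isPath_notMem_support {x y z : V} (h : (G.induce {u | u ≠ z}).Preconnected)
    (hx : x ≠ z) (hy : y ≠ z) : ∃ p : G.Walk x y, p.IsPath ∧ z ∉ p.support := by
  obtain ⟨p, hp⟩ := (h ⟨x, hx⟩ ⟨y, hy⟩).exists_isPath
  let f : G.induce {u | u ≠ z} →g G := (Embedding.induce _).toHom
  have hz : z ∉ (p.map f).support := by
    rw [Walk.support_map, List.mem_map]
    rintro ⟨w, -, hw⟩
    exact w.2 hw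
  exact ⟨p.map f, hp.map Subtype.val_injective, hz⟩

/-- A path with two distinct vertices in `N` splits into an initial and a final segment both
meeting `N`. -/
lemma Walk.IsPath.exists_split_s5 {N : Set V} {x y q r : V} {p : G.Walk x y} (hp : p.IsPath)
    (hqr : q ≠ r) (hq : q ∈ p.support) (hr : r ∈ p.support) (hqN : q ∈ N) (hrN : r ∈ N) :
    ∃ X Y : Set V, (G.induce X).Connected ∧ (G.induce Y).Connected ∧ Disjoint X Y ∧
      (∃ a ∈ X, ∃ b ∈ Y, G.Adj a b) ∧ x ∈ X ∧ y ∈ Y ∧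
      X ⊆ {v | v ∈ p.support} ∧ Y ⊆ {v | v ∈ p.support} ∧
      (X ∩ N).Nonempty ∧ (Y ∩ N).Nonempty := by
  induction p with
  | nil =>
    simp only [Walk.support_nil, List.mem_singleton] at hq hr
    exact absurd (hq.trans hr.symm) hqr
  | @cons x x' y hadj p ih =>
    rw [Walk.cons_isPath_iff] at hp
    obtain ⟨hp, hx⟩ := hp
    rw [Walk.support_cons, List.mem_cons] at hq hr
    have hsub : {v | v ∈ p.support} ⊆ {v | v ∈ (Walk.cons hadj p).support} :=
      fun v hv ↦ List.mem_cons_of_mem _ hv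
    by_cases hxN : x ∈ N
    · refine ⟨{x}, {v | v ∈ p.support}, Connected.of_subsingleton,
        p.connected_induce_support, Set.disjoint_singleton_left.mpr hx,
        ⟨x, rfl, x', p.start_mem_support, hadj⟩, rfl, p.end_mem_support, ?_, hsub,
        ⟨x, rfl, hxN⟩, ?_⟩
      · exact Set.singleton_subset_iff.mpr (Walk.start_mem_support _)
      · rcases hq with rfl | hq
        · exact ⟨r, hr.resolve_left hqr.symm, hrN⟩
        · exact ⟨q, hq, hqN⟩
    · obtain ⟨X, Y, hX, hY, hXY, ⟨a, ha, b, hb, hab⟩, hx'X, hyY, hXp, hYp, hXN, hYN⟩ :=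
        ih hp (hq.resolve_left (by rintro rfl; exact hxN hqN))
          (hr.resolve_left (by rintro rfl; exact hxN hrN))
      refine ⟨{x} ∪ X, Y, ?_, hY, ?_, ⟨a, .inr ha, b, hb, hab⟩, .inl rfl, hyY, ?_,
        hYp.trans hsub, hXN.mono (Set.inter_subset_inter_left _ Set.subset_union_right), hYN⟩
      · exact connected_induce_union Preconnected.of_subsingleton hX.preconnected rfl hx'X hadj
      · exact Set.disjoint_union_left.mpr
          ⟨Set.disjoint_singleton_left.mpr fun h ↦ hx (hYp h), hXY⟩
      · exact Set.union_subset (Set.singleton_subset_iff.mpr (Walk.start_mem_support _))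
          (hXp.trans hsub)

/-- In a finite graph, any vertex outside `P` lies in a connected set `Z` disjoint from `P` such
that every edge leaving `Z` ends in `P`. -/
lemma exists_connected_disjoint_closed [Finite V] {P : Set V} {z : V} (hz : z ∉ P) :
    ∃ Z : Set V, (G.induce Z).Connected ∧ Disjoint Z P ∧ z ∈ Z ∧
      ∀ a ∈ Z, ∀ b ∉ Z, G.Adj a b → b ∈ P := by
  obtain ⟨Z, ⟨hZ, hZP, hzZ⟩, hmax⟩ :=
    (Set.toFinite {Z : Set V | (G.induce Z).Connected ∧ Disjoint Z P ∧ z ∈ Z}).exists_maximal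
      ⟨{z}, Connected.of_subsingleton, Set.disjoint_singleton_left.mpr hz, rfl⟩
  refine ⟨Z, hZ, hZP, hzZ, fun a ha b hb hab ↦ ?_⟩
  by_contra hbP
  refine hb (hmax (y := Z ∪ {b}) ⟨?_, ?_, .inl hzZ⟩ Set.subset_union_left (.inr rfl))
  · exact connected_induce_union hZ.preconnected Preconnected.of_subsingleton ha rfl hab
  · exact Set.disjoint_union_left.mpr ⟨hZP, Set.disjoint_singleton_left.mpr hbP⟩

end SimpleGraph

lemma TwoConnected.rootedK3Minor {V : Type} [Finite V] {G : SimpleGraph V} (hG : TwoConnected G)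
    {x y z : V} (hxy : x ≠ y) (hxz : x ≠ z) (hyz : y ≠ z) : RootedK3Minor G x y z := by
  obtain ⟨p, hp, hzp⟩ := SimpleGraph.exists_isPath_notMem_support (hG.2.2 z).preconnected hxz hyz
  obtain ⟨Z, hZ, hZp, hzZ, hclosed⟩ :=
    SimpleGraph.exists_connected_disjoint_closed (G := G) (P := {v | v ∈ p.support}) hzp
  have key : ∀ w ∈ p.support, ∃ q ∈ p.support, q ≠ w ∧ ∃ a ∈ Z, G.Adj q a := by
    intro w hw
    obtain ⟨e, he, hew⟩ : ∃ e ∈ p.support, e ≠ w := by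
      by_cases hxw : x = w
      · exact ⟨y, p.end_mem_support, hxw ▸ hxy.symm⟩
      · exact ⟨x, p.start_mem_support, hxw⟩
    have hzw : z ≠ w := by rintro rfl; exact hzp hw
    obtain ⟨a, ha, b, hbw, hbZ, hab⟩ := SimpleGraph.exists_adj_boundary_of_preconnected_induce
      (hG.2.2 w).preconnected hzw hzZ hew fun h ↦ Set.disjoint_left.mp hZp h he
    exact ⟨b, hclosed a ha b hbZ hab, hbw, a, ha, hab.symm⟩
  obtain ⟨q, hq, -, hqZ⟩ := key x p.start_mem_support
  obtain ⟨r, hr, hrq, hrZ⟩ := key q hq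
  obtain ⟨X, Y, hX, hY, hXY, hadj, hxX, hyY, hXp, hYp, ⟨c, hcX, hcZ⟩, ⟨d, hdY, hdZ⟩⟩ :=
    hp.exists_split_s5 (N := {v | ∃ a ∈ Z, G.Adj v a}) hrq.symm hq hr hqZ hrZ
  exact ⟨X, Y, Z, hX, hY, hZ, hXY, (hZp.mono_right hXp).symm, (hZp.mono_right hYp).symm, hadj,
    ⟨c, hcX, hcZ⟩, ⟨d, hdY, hdZ⟩, hxX, hyY, hzZ⟩

lemma RootedK3Minor.reachable_induce_ne {V : Type} {G : SimpleGraph V} {x y z : V}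
    (h : RootedK3Minor G x y z) (hx : x ≠ z) (hy : y ≠ z) :
    (G.induce {u | u ≠ z}).Reachable ⟨x, hx⟩ ⟨y, hy⟩ := by
  obtain ⟨X, Y, Z, hX, hY, -, -, hXZ, hYZ, ⟨a, ha, b, hb, hab⟩, -, -, hxX, hyY, hzZ⟩ := h
  have hXY := SimpleGraph.connected_induce_union hX.preconnected hY.preconnected ha hb hab
  have hsub : X ∪ Y ⊆ {u | u ≠ z} := by
    rintro u (hu | hu) rfl
    · exact Set.disjoint_left.mp hXZ hu hzZ
    · exact Set.disjoint_left.mp hYZ hu hzZ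
  exact (hXY.preconnected ⟨x, .inl hxX⟩ ⟨y, .inr hyY⟩).map
    (SimpleGraph.induceHomOfLE G hsub).toHom

/-- A finite graph with at least 3 vertices contains a `K₃`-minor rooted at
`x, y, z` for all triples of distinct vertices if and only if it is 2-connected. -/
theorem forall_rootedK3Minor_iff_twoConnected {V : Type} [Fintype V]
    (G : SimpleGraph V) (hcard : 3 ≤ Fintype.card V) :
    (∀ x y z : V, x ≠ y → x ≠ z → y ≠ z → RootedK3Minor G x y z) ↔
      TwoConnected G := by
  refine ⟨fun h ↦ ?_, fun hG x y z hxy hxz hyz ↦ hG.rootedK3Minor hxy hxz hyz⟩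
  have hne : ∀ v : V, (G.induce {u | u ≠ v}).Connected := by
    intro v
    have : Nontrivial V := Fintype.one_lt_card_iff_nontrivial.mp (by omega)
    obtain ⟨w, hw⟩ := exists_ne v
    have : Nonempty {u | u ≠ v} := ⟨⟨w, hw⟩⟩
    refine ⟨fun ⟨a, ha⟩ ⟨b, hb⟩ ↦ ?_⟩
    by_cases hab : a = b
    · subst hab
      exact .refl _
    · exact (h a b v hab ha hb).reachable_induce_ne ha hb
  have : Nonempty V := Fintype.card_pos_iff.mp (by omega)
  refine ⟨⟨fun a b ↦ ?_⟩, by rwa [Nat.card_eq_fintype_card], hne⟩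
  obtain ⟨c, hca, hcb⟩ := ENat.exists_ne_ne_of_three_le (by simpa using hcard) a b
  exact ((hne c).preconnected ⟨a, hca.symm⟩ ⟨b, hcb.symm⟩).map
    (SimpleGraph.Embedding.induce _).toHom
end

section
/- Let $x, y, z$ be distinct vertices in a finite simple graph $G$, and suppose $G$ has a $K_3$-minor rooted at $x, y, z$. Then every vertex $v$ of $G$ is good with respect to $x, y, z$; that is, at least two of $x, y, z$ lie in the same connected component of $G - v$. -/
/-- Roots of two adjacent connected vertex sets that avoid `v` are joined by a path avoiding `v`. -/
lemma reachable_induce_ne_of_adj {V : Type*} {G : SimpleGraph V} {X Y : Set V} {v x y a b : V}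
    (hX : (G.induce X).Preconnected) (hY : (G.induce Y).Preconnected)
    (hvX : v ∉ X) (hvY : v ∉ Y) (hx : x ∈ X) (hy : y ∈ Y) (ha : a ∈ X) (hb : b ∈ Y)
    (hab : G.Adj a b) :
    (G.induce {u : V | u ≠ v}).Reachable
      ⟨x, ne_of_mem_of_not_mem hx hvX⟩ ⟨y, ne_of_mem_of_not_mem hy hvY⟩ := by
  have hXv : X ⊆ {u : V | u ≠ v} := fun _ hu => ne_of_mem_of_not_mem hu hvX
  have hYv : Y ⊆ {u : V | u ≠ v} := fun _ hu => ne_of_mem_of_not_mem hu hvY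
  have hxa := (hX ⟨x, hx⟩ ⟨a, ha⟩).map (SimpleGraph.induceHomOfLE G hXv).toHom
  have hby := (hY ⟨b, hb⟩ ⟨y, hy⟩).map (SimpleGraph.induceHomOfLE G hYv).toHom
  have hadj : (G.induce {u : V | u ≠ v}).Adj ⟨a, hXv ha⟩ ⟨b, hYv hb⟩ := hab
  exact hxa.trans (hadj.reachable.trans hby)

/-- If `G` has a `K₃`-minor rooted at distinct vertices `x, y, z`, then every
vertex of `G` is good with respect to `x, y, z`. -/
theorem good_of_rootedK3Minor {V : Type} [Fintype V] (G : SimpleGraph V)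
    (x y z : V) (hxy : x ≠ y) (hxz : x ≠ z) (hyz : y ≠ z)
    (hK3 : RootedK3Minor G x y z) (v : V) : Good G x y z v := by
  obtain ⟨X, Y, Z, hX, hY, hZ, dXY, dXZ, dYZ, ⟨a, ha, b, hb, hab⟩, ⟨c, hc, d, hd, hcd⟩,
    ⟨e, he, f, hf, hef⟩, hx, hy, hz⟩ := hK3
  by_cases hvX : v ∈ X
  · have hvY := Set.disjoint_left.mp dXY hvX
    have hvZ := Set.disjoint_left.mp dXZ hvX
    exact ⟨_, _, fun h => hyz (congrArg Subtype.val h), by simp, by simp,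
      reachable_induce_ne_of_adj hY.preconnected hZ.preconnected hvY hvZ hy hz he hf hef⟩
  by_cases hvY : v ∈ Y
  · have hvZ := Set.disjoint_left.mp dYZ hvY
    exact ⟨_, _, fun h => hxz (congrArg Subtype.val h), by simp, by simp,
      reachable_induce_ne_of_adj hX.preconnected hZ.preconnected hvX hvZ hx hz hc hd hcd⟩
  · exact ⟨_, _, fun h => hxy (congrArg Subtype.val h), by simp, by simp,
      reachable_induce_ne_of_adj hX.preconnected hY.preconnected hvX hvY hx hy ha hb hab⟩
end
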